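/- Weighted telescoping identity for staircase differences: for every Young diagram λ with at most d rows and every i ∈ [d], one has ∑_{k=1}^{d} (λ↑↑_k − λ↑↑_{k+1}) · D_{k→i} = (C_i + 1) · D_{d→i}, where λ↑↑_k := λ_k + d − 2k + 1 for k ∈ [d] and λ↑↑_{d+1} := 0 by convention. -/

import Mathlib

open Finset

/-- The Weyl dimension polynomial `WD_p(mu) = prod_{1 <= a < b <= p} ((mu_a - mu_b) + (b - a))/(b - a)`
of the integer tuple `(mu 1, ..., mu p)`. -/
def weylDim (p : ℕ) (μ : ℕ → ℤ) : ℚ :=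
  ∏ a ∈ Finset.Icc 1 p, ∏ b ∈ Finset.Icc (a + 1) p,
    (((μ a : ℚ) - (μ b : ℚ)) + ((b : ℚ) - (a : ℚ))) / ((b : ℚ) - (a : ℚ))

/-- `addBox μ y = μ + e_y`: the tuple `μ` with `1` added in coordinate `y`. -/
def addBox (μ : ℕ → ℤ) (y : ℕ) : ℕ → ℤ := fun x => μ x + if x = y then 1 else 0

/-- The dimension ratio `D^μ_{k→y} = WD_k(μ + e_y)/WD_k(μ)` for `y ≤ k`, and `0` for `k < y`
(division by zero evaluates to `0`). -/
def dimRatio (μ : ℕ → ℤ) (k y : ℕ) : ℚ :=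
  if y ≤ k then weylDim k (addBox μ y) / weylDim k μ else 0

/-- `D_{k→i}` for the Young diagram `lam`. -/
def dimR (lam : ℕ → ℕ) (k i : ℕ) : ℚ := dimRatio (fun x => (lam x : ℤ)) k i

/-- The squared one-step Clebsch–Gordan coefficient `c²_{k→i}`. -/
def csq (lam : ℕ → ℕ) (k i : ℕ) : ℚ :=
  if i ≤ k then
    |(∏ j ∈ (Finset.Icc 1 (k - 1)).erase i,
        ((((lam j : ℚ) - (lam i : ℚ)) + ((i : ℚ) - (j : ℚ))) - 1) /
          (((lam j : ℚ) - (lam i : ℚ)) + ((i : ℚ) - (j : ℚ)))) *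
      (1 / ((((lam i : ℚ) - (lam k : ℚ)) + ((k : ℚ) - (i : ℚ))) + (if i = k then 1 else 0)))|
  else 0

/-- The content `C_x = λ_x − x` of row `x`. -/
def rowContent (lam : ℕ → ℕ) (x : ℕ) : ℚ := (lam x : ℚ) - (x : ℚ)

/-- The staircase transformation `λ↑↑_k = λ_k + d − 2k + 1`. -/
def staircase (d : ℕ) (lam : ℕ → ℕ) (k : ℕ) : ℤ :=
  (lam k : ℤ) + (d : ℤ) - 2 * (k : ℤ) + 1

/-- Adding a row multiplies the Weyl dimension by the factors involving the new row. -/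
theorem weylDim_succ (n : ℕ) (μ : ℕ → ℤ) :
    weylDim (n + 1) μ = weylDim n μ * ∏ a ∈ Finset.Icc 1 n,
      (((μ a : ℚ) - (μ (n + 1) : ℚ)) + (((n + 1 : ℕ) : ℚ) - (a : ℚ))) /
        (((n + 1 : ℕ) : ℚ) - (a : ℚ)) := by
  unfold weylDim
  rw [Finset.prod_Icc_succ_top (by omega), Finset.Icc_eq_empty (a := n + 1 + 1) (by omega),
    Finset.prod_empty, mul_one, ← Finset.prod_mul_distrib]
  refine Finset.prod_congr rfl fun a ha => ?_
  rw [Finset.mem_Icc] at ha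
  rw [Finset.prod_Icc_succ_top (by omega)]

theorem weylDim_pos {n : ℕ} {μ : ℕ → ℤ}
    (hμ : ∀ a b, 1 ≤ a → a ≤ b → b ≤ n → μ b ≤ μ a) : 0 < weylDim n μ := by
  unfold weylDim
  refine Finset.prod_pos fun a ha => Finset.prod_pos fun b hb => ?_
  rw [Finset.mem_Icc] at ha hb
  have h1 : (μ b : ℚ) ≤ μ a := by exact_mod_cast hμ a b ha.1 (by omega) hb.2
  have h2 : (a : ℚ) + 1 ≤ b := by exact_mod_cast hb.1
  exact div_pos (by linarith) (by linarith)

/-- One-step recurrence of the dimension ratios in the number of rows. -/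
theorem dimRatio_succ_mul {n i : ℕ} {μ : ℕ → ℤ} (hi : 1 ≤ i) (hin : i ≤ n)
    (hμ : ∀ a b, 1 ≤ a → a ≤ b → b ≤ n + 1 → μ b ≤ μ a) :
    dimRatio μ (n + 1) i * ((μ i : ℚ) - μ (n + 1) + ((n + 1 : ℕ) - i)) =
      dimRatio μ n i * ((μ i : ℚ) - μ (n + 1) + ((n + 1 : ℕ) - i) + 1) := by
  have hn : weylDim n μ ≠ 0 := (weylDim_pos fun a b h1 h2 h3 => hμ a b h1 h2 (by omega)).ne'
  have hn' : weylDim (n + 1) μ ≠ 0 := (weylDim_pos hμ).ne'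
  have him : i ∈ Finset.Icc 1 n := Finset.mem_Icc.mpr ⟨hi, hin⟩
  have hq : ((n + 1 : ℕ) : ℚ) - i ≠ 0 := by
    have : (i : ℚ) ≤ n := by exact_mod_cast hin
    push_cast
    linarith
  have hprod : ∏ a ∈ (Finset.Icc 1 n).erase i,
      (((addBox μ i a : ℚ) - (addBox μ i (n + 1) : ℚ)) + (((n + 1 : ℕ) : ℚ) - (a : ℚ))) /
        (((n + 1 : ℕ) : ℚ) - (a : ℚ)) = ∏ a ∈ (Finset.Icc 1 n).erase i,
      (((μ a : ℚ) - (μ (n + 1) : ℚ)) + (((n + 1 : ℕ) : ℚ) - (a : ℚ))) /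
        (((n + 1 : ℕ) : ℚ) - (a : ℚ)) := by
    refine Finset.prod_congr rfl fun a ha => ?_
    simp [addBox, Finset.ne_of_mem_erase ha, show n + 1 ≠ i by omega]
  have hi1 : (addBox μ i i : ℚ) = μ i + 1 := by simp [addBox]
  have hi2 : addBox μ i (n + 1) = μ (n + 1) := by simp [addBox, show n + 1 ≠ i by omega]
  rw [dimRatio, dimRatio, if_pos (by omega), if_pos hin, div_mul_eq_mul_div, div_mul_eq_mul_div,
    div_eq_div_iff hn' hn, weylDim_succ n μ, weylDim_succ n (addBox μ i),
    ← Finset.mul_prod_erase _ _ him, ← Finset.mul_prod_erase _ _ him, hprod, hi1, hi2]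
  field_simp
  ring

theorem weighted_telescoping_staircase
    (d : ℕ) (hd : 1 ≤ d) (lam : ℕ → ℕ)
    (hlam : ∀ k, 1 ≤ k → k + 1 ≤ d → lam (k + 1) ≤ lam k)
    (i : ℕ) (hi : i ∈ Finset.Icc 1 d) :
    ∑ k ∈ Finset.Icc 1 d,
        ((staircase d lam k : ℚ) - (if k + 1 ≤ d then (staircase d lam (k + 1) : ℚ) else 0))
          * dimR lam k i
      = (rowContent lam i + 1) * dimR lam d i := by
  obtain ⟨hi1, hid⟩ := Finset.mem_Icc.mp hi
  have hanti : ∀ a b, 1 ≤ a → a ≤ b → b ≤ d → (lam b : ℤ) ≤ lam a := by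
    intro a b ha hab
    induction b, hab using Nat.le_induction with
    | base => exact fun _ => le_rfl
    | succ b hab ih =>
      intro hb
      have := hlam b (by omega) hb
      have := ih (by omega)
      omega
  have key : ∀ n, i ≤ n → n ≤ d →
      ∑ k ∈ Finset.Ico 1 n, ((lam k : ℚ) - lam (k + 1) + 2) * dimR lam k i
        + ((lam n : ℚ) - n + 1) * dimR lam n i = (rowContent lam i + 1) * dimR lam n i := by
    intro n hn
    induction n, hn using Nat.le_induction with
    | base =>
      intro _
      rw [Finset.sum_eq_zero, zero_add, rowContent]
      intro k hk
      rw [Finset.mem_Ico] at hk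
      rw [dimR, dimRatio, if_neg (by omega), mul_zero]
    | succ n hn ih =>
      intro hnd
      have hrec := dimRatio_succ_mul (μ := fun x => (lam x : ℤ)) hi1 hn
        fun a b h1 h2 h3 => hanti a b h1 h2 (by omega)
      have ih := ih (by omega)
      rw [Finset.sum_Ico_succ_top (by omega)]
      simp only [rowContent, dimR] at ih ⊢
      push_cast at hrec ⊢
      linear_combination ih - hrec
  rw [← key d hid le_rfl, ← Finset.Ico_add_one_right_eq_Icc, Finset.sum_Ico_succ_top hd,
    if_neg (by omega)]
  congr 1
  · refine Finset.sum_congr rfl fun k hk => ?_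
    rw [Finset.mem_Ico] at hk
    rw [if_pos (by omega)]
    simp only [staircase]
    push_cast
    ring
  · simp only [staircase]
    push_cast
    ring
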